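/- arXiv:1010.4761 — 2 statements merged into one kernel-verified Lean document; each statement's English description precedes it below -/
import Mathlib

section
/- (Theorem 3, injectivity part) Let (M,(f_i)) and (M',(f'_i)) be stable pairs, where M, M' are A-modules with graded framings whose total maps are f and f'. Then range Φ_{(M,f)} = range Φ_{(M',f')} as A-submodules of Hom_k(A,V) if and only if there exists an isomorphism of A-modules g : M → M' with f'_i ∘ g = f_i for every i. -/
/-- `Φ : M →ₗ[k] Hom_k(A,V)`, `Φ(m)(a) = f (a • m)` (the `k`-linear version). -/
noncomputable def framedPhiL {k : Type*} (A : Type*) {M V : Type*} [Field k] [Ring A]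
    [Algebra k A] [AddCommGroup M] [Module k M] [Module A M] [IsScalarTower k A M]
    [SMulCommClass k A M] [AddCommGroup V] [Module k V] (f : M →ₗ[k] V) :
    M →ₗ[k] (A →ₗ[k] V) where
  toFun m :=
    { toFun := fun a => f (a • m)
      map_add' := fun a b => by
        show f ((a + b) • m) = f (a • m) + f (b • m); rw [add_smul, map_add]
      map_smul' := fun c a => by
        show f ((c • a) • m) = c • f (a • m); rw [smul_assoc, map_smul] }
  map_add' m₁ m₂ := by
    ext a; show f (a • (m₁ + m₂)) = f (a • m₁) + f (a • m₂); rw [smul_add, map_add]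
  map_smul' c m := by
    ext a
    show f (a • c • m) = c • f (a • m)
    rw [← smul_comm c a m, map_smul]

section framedPhiL

variable {k A M V : Type*} [Field k] [Ring A] [Algebra k A] [AddCommGroup M] [Module k M]
  [Module A M] [IsScalarTower k A M] [SMulCommClass k A M] [AddCommGroup V] [Module k V]

theorem framedPhiL_apply (f : M →ₗ[k] V) (m : M) (a : A) : framedPhiL A f m a = f (a • m) := rfl

/-- `framedPhiL` is `A`-equivariant for the action `(b • g)(a) = g (a * b)` on `Hom_k(A, V)`. -/
theorem framedPhiL_smul (f : M →ₗ[k] V) (b : A) (m : M) :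
    framedPhiL A f (b • m) = framedPhiL A f m ∘ₗ LinearMap.mulRight k b := by
  ext a
  simp [framedPhiL_apply, mul_smul]

theorem framedPhiL_injective (f : M →ₗ[k] V)
    (hf : ∀ N : Submodule A M, (∀ m ∈ N, f m = 0) → N = ⊥) :
    Function.Injective (framedPhiL A f) := by
  rw [injective_iff_map_eq_zero]
  intro m hm
  rw [← Submodule.span_singleton_eq_bot (R := A)]
  refine hf _ fun x hx => ?_
  obtain ⟨a, rfl⟩ := Submodule.mem_span_singleton.1 hx
  exact LinearMap.congr_fun hm a

variable {M' : Type*} [AddCommGroup M'] [Module k M'] [Module A M'] [IsScalarTower k A M']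
  [SMulCommClass k A M']

theorem exists_linearEquiv_of_range_framedPhiL_eq {f : M →ₗ[k] V} {f' : M' →ₗ[k] V}
    (hf : Function.Injective (framedPhiL A f)) (hf' : Function.Injective (framedPhiL A f'))
    (h : Set.range (framedPhiL A f) = Set.range (framedPhiL A f')) :
    ∃ g : M ≃ₗ[A] M', ∀ m, f' (g m) = f m := by
  have hex : ∀ m, ∃ m', framedPhiL A f' m' = framedPhiL A f m := fun m =>
    h.subset (Set.mem_range_self m)
  choose g hg using hex
  let gl : M →ₗ[A] M' :=
    { toFun := g
      map_add' := fun x y => hf' (by simp only [map_add, hg])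
      map_smul' := fun a x => hf' (by simp only [RingHom.id_apply, framedPhiL_smul, hg]) }
  have hbij : Function.Bijective gl := by
    refine ⟨fun x y hxy => hf ?_, fun y => ?_⟩
    · rw [← hg x, ← hg y]
      exact congrArg _ hxy
    · obtain ⟨x, hx⟩ := h.superset (Set.mem_range_self y)
      exact ⟨x, hf' ((hg x).trans hx)⟩
  refine ⟨LinearEquiv.ofBijective gl hbij, fun m => ?_⟩
  have h1 := LinearMap.congr_fun (hg m) 1
  simp only [framedPhiL_apply, one_smul] at h1
  exact h1

theorem range_framedPhiL_eq_of_linearEquiv {f : M →ₗ[k] V} {f' : M' →ₗ[k] V} (g : M ≃ₗ[A] M')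
    (hg : ∀ m, f' (g m) = f m) :
    Set.range (framedPhiL A f) = Set.range (framedPhiL A f') := by
  have hcomp : ⇑(framedPhiL A f) = framedPhiL A f' ∘ g := by
    ext m a
    simp [framedPhiL_apply, ← hg]
  rw [hcomp, g.surjective.range_comp]

end framedPhiL

/-- (Theorem 3, injectivity part) Let `e 1, …, e n` be complete orthogonal idempotents in `A` and
let `(M, (f i))`, `(M', (f' i))` be stable pairs (graded framings with no nonzero `A`-submodule
inside the common kernel of the framing maps).  Then the ranges of `Φ_{(M,f)}` and
`Φ_{(M',f')}` in `Hom_k(A, Π i, V i)` coincide if and only if there is an isomorphism of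
`A`-modules `g : M ≃ M'` with `f' i ∘ g = f i` for every `i`. -/
theorem framedPhiL_range_eq_iff_iso {k A M M' : Type*} {n : ℕ} {V : Fin n → Type*} [Field k]
    [Ring A] [Algebra k A]
    [AddCommGroup M] [Module k M] [Module A M] [IsScalarTower k A M] [SMulCommClass k A M]
    [AddCommGroup M'] [Module k M'] [Module A M'] [IsScalarTower k A M'] [SMulCommClass k A M']
    [∀ i, AddCommGroup (V i)] [∀ i, Module k (V i)]
    (e : Fin n → A) (hidem : ∀ i, e i * e i = e i)
    (horth : ∀ i j, i ≠ j → e i * e j = 0) (hsum : ∑ i, e i = 1)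
    (f : ∀ i, M →ₗ[k] V i) (hframe : ∀ i m, f i m = f i (e i • m))
    (hstab : ∀ N : Submodule A M, (∀ m ∈ N, ∀ i, f i m = 0) → N = ⊥)
    (f' : ∀ i, M' →ₗ[k] V i) (hframe' : ∀ i m, f' i m = f' i (e i • m))
    (hstab' : ∀ N : Submodule A M', (∀ m ∈ N, ∀ i, f' i m = 0) → N = ⊥) :
    Set.range (framedPhiL A (LinearMap.pi f)) = Set.range (framedPhiL A (LinearMap.pi f')) ↔
      ∃ g : M ≃ₗ[A] M', ∀ (i : Fin n) (m : M), f' i (g m) = f i m := by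
  constructor
  · intro h
    obtain ⟨g, hg⟩ := exists_linearEquiv_of_range_framedPhiL_eq
      (framedPhiL_injective _ fun N hN => hstab N fun m hm => congrFun (hN m hm))
      (framedPhiL_injective _ fun N hN => hstab' N fun m hm => congrFun (hN m hm)) h
    exact ⟨g, fun i m => congrFun (hg m) i⟩
  · rintro ⟨g, hg⟩
    exact range_framedPhiL_eq_of_linearEquiv g fun m => funext fun i => hg i m
end

section
/- (Proposition 4, commutator step) Let k be a field of characteristic zero, V a finite-dimensional k-vector space, and σ, τ k-linear endomorphisms of V such that every composition of a nonempty finite sequence of operators, each equal to σ or to τ, is nilpotent. Then the commutator σ∘τ − τ∘σ is nilpotent. -/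
open Polynomial in
/-- In characteristic zero, an endomorphism whose positive powers all have trace zero is
nilpotent. -/
theorem isNilpotent_of_trace_pow_succ_eq_zero {k V : Type*} [Field k] [CharZero k]
    [AddCommGroup V] [Module k V] [FiniteDimensional k V] (a : Module.End k V)
    (h : ∀ n : ℕ, LinearMap.trace k V (a ^ (n + 1)) = 0) : IsNilpotent a := by
  have htrace (p : k[X]) : LinearMap.trace k V (aeval a (p * X)) = 0 := by
    induction p using Polynomial.induction_on' with
    | add p q hp hq => rw [add_mul, map_add, map_add, hp, hq, add_zero]
    | monomial n c =>
      rw [← C_mul_X_pow_eq_monomial, mul_assoc, ← pow_succ, map_mul, aeval_C, map_pow, aeval_X,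
        ← Algebra.smul_def, map_smul, h, smul_zero]
  obtain ⟨q, hq, hX⟩ := exists_eq_pow_rootMultiplicity_mul_and_not_dvd (minpoly k a)
    (minpoly.ne_zero (Algebra.IsIntegral.isIntegral a)) 0
  rw [C_0, sub_zero] at hq hX
  set m := rootMultiplicity 0 (minpoly k a)
  have hzero : aeval a (X ^ (m + 1) * q) = 0 := by
    rw [pow_succ', mul_assoc, ← hq, map_mul, minpoly.aeval, mul_zero]
  obtain ⟨u, v, huv⟩ : IsCoprime (X ^ (m + 1)) q :=
    ((irreducible_X.coprime_iff_not_dvd).2 hX).pow_left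
  set e := aeval a (u * X ^ (m + 1)) with he
  have hidem : IsIdempotentElem e := by
    have : e * (1 - e) = 0 := by
      have h1 : 1 - e = aeval a (v * q) := by
        rw [he, ← map_one (aeval (R := k) a), ← huv, ← map_sub, add_sub_cancel_left]
      rw [h1, he, ← map_mul, mul_mul_mul_comm, map_mul, hzero, mul_zero]
    rw [mul_sub, mul_one, sub_eq_zero] at this
    exact this.symm
  have he0 : e = 0 := by
    have ht : LinearMap.trace k V e = 0 := by
      rw [he, pow_succ, ← mul_assoc]
      exact htrace _
    exact LinearMap.IsIdempotentElem.eq_zero_of_trace_eq_zero hidem ht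
  refine ⟨m + 1, ?_⟩
  have := congrArg (fun p ↦ aeval a (X ^ (m + 1) * p)) huv
  rw [mul_add, map_add, map_mul, ← he, he0, mul_zero, zero_add, mul_left_comm, map_mul, hzero,
    mul_zero, mul_one, map_pow, aeval_X] at this
  exact this.symm

/-- In characteristic zero, if all elements of the multiplicative semigroup generated by `s` are
nilpotent, then so are all elements of the non-unital algebra generated by `s`. -/
theorem isNilpotent_of_mem_adjoin {k V : Type*} [Field k] [CharZero k]
    [AddCommGroup V] [Module k V] [FiniteDimensional k V] {s : Set (Module.End k V)}
    (hs : ∀ x ∈ Subsemigroup.closure s, IsNilpotent x) {a : Module.End k V}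
    (ha : a ∈ NonUnitalAlgebra.adjoin k s) : IsNilpotent a := by
  have htrace : ∀ x ∈ NonUnitalAlgebra.adjoin k s, LinearMap.trace k V x = 0 := by
    have hle : (NonUnitalAlgebra.adjoin k s).toSubmodule ≤ LinearMap.ker (LinearMap.trace k V) := by
      rw [NonUnitalAlgebra.adjoin_eq_span, Submodule.span_le]
      exact fun x hx ↦ (LinearMap.isNilpotent_trace_of_isNilpotent (hs x hx)).eq_zero
    exact fun x hx ↦ hle hx
  refine isNilpotent_of_trace_pow_succ_eq_zero a fun n ↦ htrace _ ?_
  induction n with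
  | zero => simpa using ha
  | succ n ih => rw [pow_succ]; exact mul_mem ih ha

/-- Elements of a subsemigroup closure in a monoid are products of nonempty lists of
generators. -/
theorem exists_list_prod_of_mem_subsemigroup_closure {M : Type*} [Monoid M] {s : Set M} {x : M}
    (hx : x ∈ Subsemigroup.closure s) : ∃ l : List M, l ≠ [] ∧ (∀ y ∈ l, y ∈ s) ∧ l.prod = x := by
  induction hx using Subsemigroup.closure_induction with
  | mem x hx => exact ⟨[x], by simp, by simpa using hx, by simp⟩
  | mul x y _ _ hx hy =>
    obtain ⟨l, hl, hls, rfl⟩ := hx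
    obtain ⟨l', -, hls', rfl⟩ := hy
    refine ⟨l ++ l', by simp [hl], fun y hy ↦ ?_, List.prod_append⟩
    exact (List.mem_append.1 hy).elim (hls y) (hls' y)


/-- (Proposition 4, commutator step) Let `k` be a field of characteristic zero, `V` a
finite-dimensional `k`-vector space, and `σ, τ` endomorphisms of `V` such that every composition
of a nonempty finite sequence of operators each equal to `σ` or `τ` is nilpotent.  Then the
commutator `σ∘τ − τ∘σ` is nilpotent. -/
theorem commutator_isNilpotent_of_words_nilpotent {k V : Type*} [Field k] [CharZero k]
    [AddCommGroup V] [Module k V] [FiniteDimensional k V] (σ τ : Module.End k V)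
    (hnil : ∀ l : List (Module.End k V), l ≠ [] → (∀ x ∈ l, x = σ ∨ x = τ) →
      IsNilpotent l.prod) :
    IsNilpotent (σ * τ - τ * σ) := by
  have hs : ∀ x ∈ Subsemigroup.closure {σ, τ}, IsNilpotent x := fun x hx ↦ by
    obtain ⟨l, hl, hmem, rfl⟩ := exists_list_prod_of_mem_subsemigroup_closure hx
    exact hnil l hl hmem
  have hσ : σ ∈ NonUnitalAlgebra.adjoin k {σ, τ} :=
    NonUnitalAlgebra.subset_adjoin k (by simp)
  have hτ : τ ∈ NonUnitalAlgebra.adjoin k {σ, τ} :=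
    NonUnitalAlgebra.subset_adjoin k (by simp)
  exact isNilpotent_of_mem_adjoin hs (sub_mem (mul_mem hσ hτ) (mul_mem hτ hσ))
end
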